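/- arXiv:2012.10016 — 3 statements merged into one kernel-verified Lean document; each statement's English description precedes it below -/
import Mathlib

section
/- Let L be a K-linear subspace of KΔ_≺(I) (so that L_X is a standard evaluation code on X relative to ≺). Then dim_K(L) + dim_K(L^⊥) = |X|, where L^⊥ = (ker φ : L) ∩ KΔ_≺(I) is the algebraic dual of L. -/
open MvPolynomial

noncomputable section

variable {K : Type*} [Field K] {s m : ℕ}

/-- Evaluation linear map at a family of points. -/
def evalMap (P : Fin m → (Fin s → K)) :
    MvPolynomial (Fin s) K →ₗ[K] (Fin m → K) :=
  LinearMap.pi fun i => (MvPolynomial.aeval (P i)).toLinearMap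

/-- Vanishing ideal of a finite family of points. -/
def vanishingIdeal (P : Fin m → (Fin s → K)) : Ideal (MvPolynomial (Fin s) K) :=
  ⨅ i, RingHom.ker (MvPolynomial.eval (P i))

/-- The linear map `φ : f ↦ ∑ i, f(P i)`. -/
def sumEval (P : Fin m → (Fin s → K)) : MvPolynomial (Fin s) K →ₗ[K] K :=
  ∑ i, (MvPolynomial.aeval (P i)).toLinearMap

/-- The leading exponent (initial monomial exponent) of a polynomial w.r.t. a monomial order. -/
def leadExpo (mo : MonomialOrder (Fin s)) (f : MvPolynomial (Fin s) K) : Fin s →₀ ℕ :=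
  mo.toSyn.symm (f.support.sup fun a => mo.toSyn a)

/-- The initial ideal of `I` w.r.t. a monomial order. -/
def initialIdeal (mo : MonomialOrder (Fin s)) (I : Ideal (MvPolynomial (Fin s) K)) :
    Ideal (MvPolynomial (Fin s) K) :=
  Ideal.span ((fun f => (monomial (leadExpo mo f) (1 : K))) '' {f | f ∈ I ∧ f ≠ 0})

/-- The set of exponents of standard monomials of `S/I`. -/
def stdMon (mo : MonomialOrder (Fin s)) (I : Ideal (MvPolynomial (Fin s) K)) :
    Set (Fin s →₀ ℕ) :=
  {a | monomial a (1 : K) ∉ initialIdeal mo I}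

/-- `K Δ_≺(I)`, the span of the standard monomials. -/
def stdSpan (mo : MonomialOrder (Fin s)) (I : Ideal (MvPolynomial (Fin s) K)) :
    Submodule K (MvPolynomial (Fin s) K) :=
  Submodule.span K ((fun a => monomial a (1 : K)) '' stdMon mo I)

/-- The space `(ker φ : L) = {g | g·f ∈ ker φ for all f ∈ L}`. -/
def colonKer (φ : MvPolynomial (Fin s) K →ₗ[K] K)
    (L : Submodule K (MvPolynomial (Fin s) K)) : Submodule K (MvPolynomial (Fin s) K) where
  carrier := {g | ∀ f ∈ L, φ (g * f) = 0}
  add_mem' := fun ha hb f hf => by rw [add_mul, map_add, ha f hf, hb f hf, add_zero]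
  zero_mem' := fun f hf => by rw [zero_mul, map_zero]
  smul_mem' := fun c a ha f hf => by rw [smul_mul_assoc, map_smul, ha f hf, smul_zero]

/-- The algebraic dual `L^⊥ = (ker φ : L) ∩ KΔ_≺(I)`. -/
def algDual (P : Fin m → (Fin s → K)) (mo : MonomialOrder (Fin s))
    (L : Submodule K (MvPolynomial (Fin s) K)) : Submodule K (MvPolynomial (Fin s) K) :=
  colonKer (sumEval P) L ⊓ stdSpan mo (vanishingIdeal P)

/-- The dual of a linear code in `K^m`. -/
def dualCode (C : Submodule K (Fin m → K)) : Submodule K (Fin m → K) where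
  carrier := {α | ∀ β ∈ C, ∑ i, α i * β i = 0}
  add_mem' := fun ha hb β hβ => by
    simp only [Pi.add_apply, add_mul, Finset.sum_add_distrib]
    rw [ha β hβ, hb β hβ, add_zero]
  zero_mem' := fun β hβ => by simp
  smul_mem' := fun c a ha β hβ => by
    simp only [Pi.smul_apply, smul_eq_mul, mul_assoc, ← Finset.mul_sum]
    rw [ha β hβ, mul_zero]

/-- Coordinatewise scaling of `K^m` by a vector `β`. -/
def scaleMap (β : Fin m → K) : (Fin m → K) →ₗ[K] (Fin m → K) :=
  LinearMap.pi fun i => β i • LinearMap.proj i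

/-- A monomial order is graded if it refines total degree. -/
def MonomialOrder.IsGraded (mo : MonomialOrder (Fin s)) : Prop :=
  ∀ a b : Fin s →₀ ℕ, Finsupp.degree a < Finsupp.degree b → mo.toSyn a < mo.toSyn b

/-- The affine Hilbert function of the vanishing ideal of the points `P`. -/
def hilbA (P : Fin m → (Fin s → K)) (d : ℕ) : ℕ :=
  Module.finrank K
    (Submodule.map (Ideal.Quotient.mkₐ K (vanishingIdeal P)).toLinearMap
      (restrictTotalDegree (Fin s) K d))

/-- The affine Hilbert function, with `H(d) = 0` for `d < 0`. -/
def hilbAZ (P : Fin m → (Fin s → K)) (d : ℤ) : ℕ :=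
  if d < 0 then 0 else hilbA P d.toNat

/-- The Reed–Muller-type code of degree `d` on the points `P`. -/
def RMcode (P : Fin m → (Fin s → K)) (d : ℕ) : Submodule K (Fin m → K) :=
  Submodule.map (evalMap P) (restrictTotalDegree (Fin s) K d)

/-- The Reed–Muller-type code indexed by an integer degree, `⊥` for `d < 0`. -/
def RMcodeZ (P : Fin m → (Fin s → K)) (d : ℤ) : Submodule K (Fin m → K) :=
  if d < 0 then ⊥ else RMcode P d.toNat

/-- The vanishing ideal of a single point. -/
def pointIdeal (Q : Fin s → K) : Ideal (MvPolynomial (Fin s) K) :=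
  RingHom.ker (MvPolynomial.eval Q)

/-- The local v-number `v_𝔭(I)`. -/
def vNumAt (I 𝔭 : Ideal (MvPolynomial (Fin s) K)) : ℕ :=
  sInf {d | ∃ f : MvPolynomial (Fin s) K, f ≠ 0 ∧ f.totalDegree = d ∧
    I.colon (Ideal.span {f}) = 𝔭}

/-- `f` is an indicator function for the `i`-th point. -/
def IsIndicator (P : Fin m → (Fin s → K)) (f : MvPolynomial (Fin s) K) (i : Fin m) : Prop :=
  MvPolynomial.eval (P i) f ≠ 0 ∧ ∀ j, j ≠ i → MvPolynomial.eval (P j) f = 0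

/-- The minimum distance of a linear code. -/
def minDist (C : Submodule K (Fin m → K)) : ℕ :=
  sInf {w | ∃ v ∈ C, v ≠ 0 ∧ Set.ncard {i | v i ≠ 0} = w}

theorem mem_initialIdeal_iff (mo : MonomialOrder (Fin s))
    (I : Ideal (MvPolynomial (Fin s) K)) (a : Fin s →₀ ℕ) :
    monomial a (1 : K) ∈ initialIdeal mo I ↔ ∃ f ∈ I, f ≠ 0 ∧ mo.degree f ≤ a := by
  have h : initialIdeal mo I = Ideal.span
      ((fun b => monomial b (1 : K)) '' (mo.degree '' {f | f ∈ I ∧ f ≠ 0})) := by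
    rw [Set.image_image]
    rfl
  rw [h, mem_ideal_span_monomial_image]
  classical
  simp [support_monomial, and_assoc]

theorem mem_stdSpan_iff (mo : MonomialOrder (Fin s))
    (I : Ideal (MvPolynomial (Fin s) K)) (f : MvPolynomial (Fin s) K) :
    f ∈ stdSpan mo I ↔ ∀ a ∈ f.support, a ∈ stdMon mo I := by
  rw [stdSpan, ← restrictSupport_eq_span, mem_restrictSupport_iff]
  rfl

theorem eq_zero_of_mem_stdSpan_of_mem {mo : MonomialOrder (Fin s)}
    {I : Ideal (MvPolynomial (Fin s) K)} {f : MvPolynomial (Fin s) K}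
    (hf : f ∈ stdSpan mo I) (hI : f ∈ I) : f = 0 := by
  by_contra h0
  exact (mem_stdSpan_iff mo I f).mp hf _ (mo.degree_mem_support h0)
    ((mem_initialIdeal_iff mo I _).mpr ⟨f, hI, h0, le_rfl⟩)

theorem exists_mem_stdSpan_sub_mem (mo : MonomialOrder (Fin s))
    (I : Ideal (MvPolynomial (Fin s) K)) (f : MvPolynomial (Fin s) K) :
    ∃ r ∈ stdSpan mo I, f - r ∈ I := by
  obtain ⟨g, r, hfr, -, hr⟩ := mo.div_set (B := {b | b ∈ I ∧ b ≠ 0})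
    (fun b hb => isUnit_iff_ne_zero.mpr (mo.leadingCoeff_ne_zero_iff.mpr hb.2)) f
  refine ⟨r, (mem_stdSpan_iff mo I r).mpr fun a ha hmem => ?_, ?_⟩
  · obtain ⟨b, hbI, hb0, hba⟩ := (mem_initialIdeal_iff mo I a).mp hmem
    exact hr a ha b ⟨hbI, hb0⟩ hba
  · rw [hfr, add_sub_cancel_right, Finsupp.linearCombination_apply]
    exact Submodule.sum_mem _ fun b _ => I.smul_mem _ b.2.1

theorem evalMap_apply (P : Fin m → (Fin s → K)) (f : MvPolynomial (Fin s) K) (i : Fin m) :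
    evalMap P f i = eval (P i) f := by
  simp [evalMap, aeval_eq_eval]

theorem mem_vanishingIdeal_iff_evalMap_eq_zero (P : Fin m → (Fin s → K)) (f : MvPolynomial (Fin s) K) :
    f ∈ vanishingIdeal P ↔ evalMap P f = 0 := by
  simp [_root_.vanishingIdeal, _root_.funext_iff, evalMap_apply]

theorem sumEval_mul (P : Fin m → (Fin s → K)) (g f : MvPolynomial (Fin s) K) :
    sumEval P (g * f) = evalMap P g ⬝ᵥ evalMap P f := by
  simp [sumEval, dotProduct, evalMap_apply, aeval_eq_eval]

theorem evalMap_surjective [Finite K] {P : Fin m → (Fin s → K)} (hP : Function.Injective P) :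
    Function.Surjective (evalMap P) := by
  intro v
  have := Fintype.ofFinite K
  obtain ⟨f, -, hf⟩ := (map_restrict_dom_evalₗ K (Fin s)).ge
    (Submodule.mem_top (x := Function.extend P v 0))
  refine ⟨f, funext fun i => ?_⟩
  rw [evalMap_apply, ← evalₗ_apply, hf, hP.extend_apply]

/-- Evaluation at distinct points restricts to an isomorphism from the span of the standard
monomials onto `K^m`. -/
def stdSpanEquiv [Finite K] {P : Fin m → (Fin s → K)} (hP : Function.Injective P)
    (mo : MonomialOrder (Fin s)) : stdSpan mo (vanishingIdeal P) ≃ₗ[K] (Fin m → K) :=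
  LinearEquiv.ofBijective ((evalMap P).domRestrict (stdSpan mo (vanishingIdeal P))) <| by
    constructor
    · rw [injective_iff_map_eq_zero]
      exact fun f hf => Subtype.ext
        (eq_zero_of_mem_stdSpan_of_mem f.2 ((mem_vanishingIdeal_iff_evalMap_eq_zero P _).mpr hf))
    · intro v
      obtain ⟨f, rfl⟩ := evalMap_surjective hP v
      obtain ⟨r, hr, hfr⟩ := exists_mem_stdSpan_sub_mem mo (vanishingIdeal P) f
      rw [mem_vanishingIdeal_iff_evalMap_eq_zero, map_sub, sub_eq_zero] at hfr
      exact ⟨⟨r, hr⟩, hfr.symm⟩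

theorem finrank_map_evalMap [Finite K] {P : Fin m → (Fin s → K)} (hP : Function.Injective P)
    {mo : MonomialOrder (Fin s)} {L : Submodule K (MvPolynomial (Fin s) K)}
    (hL : L ≤ stdSpan mo (vanishingIdeal P)) :
    Module.finrank K (L.map (evalMap P)) = Module.finrank K L := by
  have hinj : Set.InjOn (evalMap P) L := by
    intro f hf g hg hfg
    exact congrArg Subtype.val
      ((stdSpanEquiv hP mo).injective (a₁ := ⟨f, hL hf⟩) (a₂ := ⟨g, hL hg⟩) hfg)
  rw [← LinearMap.range_domRestrict]
  exact LinearMap.finrank_range_of_inj (Set.injOn_iff_injective.mp hinj)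

theorem map_algDual [Finite K] {P : Fin m → (Fin s → K)} (hP : Function.Injective P)
    (mo : MonomialOrder (Fin s)) (L : Submodule K (MvPolynomial (Fin s) K)) :
    (algDual P mo L).map (evalMap P) =
      (L.map (evalMap P)).dualAnnihilator.comap (dotProductEquiv K (Fin m)).toLinearMap := by
  ext v
  simp only [Submodule.mem_map, Submodule.mem_comap, Submodule.mem_dualAnnihilator]
  constructor
  · rintro ⟨g, hg, rfl⟩ _ ⟨f, hf, rfl⟩
    exact (sumEval_mul P g f).symm.trans (hg.1 f hf)
  · intro h
    obtain ⟨g, rfl⟩ := (stdSpanEquiv hP mo).surjective v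
    exact ⟨g, ⟨fun f hf => (sumEval_mul P _ f).trans (h _ ⟨f, hf, rfl⟩), g.2⟩, rfl⟩

/-- For a standard evaluation code, `dim L + dim L^⊥ = |X|`. -/
theorem finrank_add_finrank_algDual [Fintype K]
    (P : Fin m → (Fin s → K)) (hP : Function.Injective P) (hm : 2 ≤ m)
    (mo : MonomialOrder (Fin s))
    (L : Submodule K (MvPolynomial (Fin s) K))
    (hL : L ≤ stdSpan mo (vanishingIdeal P)) :
    Module.finrank K L + Module.finrank K (algDual P mo L) = m := by
  have h := Subspace.finrank_add_finrank_dualAnnihilator_eq (L.map (evalMap P))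
  rw [finrank_map_evalMap hP hL, Module.finrank_fin_fun] at h
  rw [← finrank_map_evalMap (L := algDual P mo L) hP inf_le_right, map_algDual hP mo L,
    Submodule.comap_equiv_eq_map_symm, LinearEquiv.finrank_map_eq, h]

end
end

section
/- Let ≺ be a graded monomial order on S and let f_1,…,f_m be the standard indicator functions for X. Then ker(φ) = K{f_i − f_m : 1 ≤ i ≤ m−1} + I, i.e. the kernel of φ is the sum of the K-span of the differences f_i − f_m and the vanishing ideal I; moreover K{f_i − f_m : 1 ≤ i ≤ m−1} = ker(φ) ∩ KΔ_≺(I). -/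
open MvPolynomial

noncomputable section

variable {K : Type*} [Field K] {s m : ℕ}

theorem mem_vanishingIdeal_iff {P : Fin m → (Fin s → K)} {f : MvPolynomial (Fin s) K} :
    f ∈ vanishingIdeal P ↔ ∀ i, eval (P i) f = 0 := by
  simp [_root_.vanishingIdeal, RingHom.mem_ker]

theorem sumEval_apply (P : Fin m → (Fin s → K)) (f : MvPolynomial (Fin s) K) :
    sumEval P f = ∑ i, eval (P i) f := by
  simp [sumEval, LinearMap.sum_apply, aeval_eq_eval]

theorem vanishingIdeal_le_ker_sumEval (P : Fin m → (Fin s → K)) :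
    Submodule.restrictScalars K (vanishingIdeal P) ≤ LinearMap.ker (sumEval P) := by
  intro f hf
  have hf' := mem_vanishingIdeal_iff.mp hf
  simp [LinearMap.mem_ker, sumEval_apply, hf']

theorem mem_stdMon_of_mem_support {mo : MonomialOrder (Fin s)}
    {I : Ideal (MvPolynomial (Fin s) K)} {h : MvPolynomial (Fin s) K}
    (hh : h ∈ stdSpan mo I) {a : Fin s →₀ ℕ} (ha : a ∈ h.support) : a ∈ stdMon mo I := by
  have hle : stdSpan mo I ≤ restrictSupport K (stdMon mo I) := by
    refine Submodule.span_le.mpr ?_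
    rintro _ ⟨b, hb, rfl⟩
    exact (mem_restrictSupport_iff K).mpr
      ((Finset.coe_subset.mpr support_monomial_subset).trans (by simpa using hb))
  exact (mem_restrictSupport_iff K).mp (hle hh) ha

/-- A nonzero element of an ideal is never a combination of standard monomials. -/
theorem eq_zero_of_mem_of_mem_stdSpan {mo : MonomialOrder (Fin s)}
    {I : Ideal (MvPolynomial (Fin s) K)} {h : MvPolynomial (Fin s) K}
    (hI : h ∈ I) (hh : h ∈ stdSpan mo I) : h = 0 := by
  by_contra h0
  exact mem_stdMon_of_mem_support hh (mo.degree_mem_support h0)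
    (Ideal.subset_span ⟨h, ⟨hI, h0⟩, rfl⟩)

/-- The interpolation of `f` by indicator functions agrees with `f` modulo the vanishing ideal. -/
theorem sub_sum_indicator_mem_vanishingIdeal {P : Fin m → (Fin s → K)}
    {F : Fin m → MvPolynomial (Fin s) K}
    (hF : ∀ i : Fin m, eval (P i) (F i) = 1 ∧ ∀ j, j ≠ i → eval (P j) (F i) = 0)
    (f : MvPolynomial (Fin s) K) :
    f - ∑ i, eval (P i) f • F i ∈ vanishingIdeal P := by
  refine mem_vanishingIdeal_iff.mpr fun j => ?_
  rw [map_sub, map_sum, Finset.sum_eq_single j]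
  · simp [smul_eval, (hF j).1]
  · intro i _ hij
    simp [smul_eval, (hF i).2 j hij.symm]
  · simp

theorem sum_smul_mem_span_sub {ι V : Type*} [Fintype ι] [AddCommGroup V] [Module K V]
    (F : ι → V) (l : ι) {c : ι → K} (hc : ∑ i, c i = 0) :
    ∑ i, c i • F i ∈ Submodule.span K ((fun i => F i - F l) '' {i | i ≠ l}) := by
  have heq : ∑ i, c i • F i = ∑ i, c i • (F i - F l) := by
    simp [smul_sub, Finset.sum_sub_distrib, ← Finset.sum_smul, hc]
  rw [heq]
  refine Submodule.sum_mem _ fun i _ => Submodule.smul_mem _ _ ?_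
  by_cases hi : i = l
  · simp [hi]
  · exact Submodule.subset_span ⟨i, hi, rfl⟩

theorem sumEval_indicator {P : Fin m → (Fin s → K)} {F : MvPolynomial (Fin s) K} {i : Fin m}
    (h1 : eval (P i) F = 1) (h0 : ∀ j, j ≠ i → eval (P j) F = 0) : sumEval P F = 1 := by
  rw [sumEval_apply, Finset.sum_eq_single i (fun j _ hj => h0 j hj) (by simp), h1]

/-- `ker φ = K{fᵢ - f_m} + I` and `K{fᵢ - f_m} = ker φ ∩ KΔ_≺(I)`. -/
theorem ker_phi_eq_span_differences_sup_ideal [Fintype K]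
    (P : Fin m → (Fin s → K)) (hP : Function.Injective P) (hm : 2 ≤ m)
    (mo : MonomialOrder (Fin s)) (hmo : mo.IsGraded)
    (F : Fin m → MvPolynomial (Fin s) K)
    (hF : ∀ i : Fin m, F i ∈ stdSpan mo (vanishingIdeal P) ∧
      MvPolynomial.eval (P i) (F i) = 1 ∧
      ∀ j : Fin m, j ≠ i → MvPolynomial.eval (P j) (F i) = 0) :
    LinearMap.ker (sumEval P) =
      Submodule.span K
          ((fun i => F i - F ⟨m - 1, by omega⟩) '' {i : Fin m | i ≠ ⟨m - 1, by omega⟩}) ⊔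
        Submodule.restrictScalars K (vanishingIdeal P) ∧
    Submodule.span K
        ((fun i => F i - F ⟨m - 1, by omega⟩) '' {i : Fin m | i ≠ ⟨m - 1, by omega⟩}) =
      LinearMap.ker (sumEval P) ⊓ stdSpan mo (vanishingIdeal P) := by
  have hspan : ∀ f ∈ LinearMap.ker (sumEval P), ∑ i, eval (P i) f • F i ∈ Submodule.span K
      ((fun i => F i - F ⟨m - 1, by omega⟩) '' {i : Fin m | i ≠ ⟨m - 1, by omega⟩}) :=
    fun f hf => sum_smul_mem_span_sub F _
      ((sumEval_apply P f).symm.trans (LinearMap.mem_ker.mp hf))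
  have hsub := sub_sum_indicator_mem_vanishingIdeal fun i => (hF i).2
  have hle : Submodule.span K
      ((fun i => F i - F ⟨m - 1, by omega⟩) '' {i : Fin m | i ≠ ⟨m - 1, by omega⟩}) ≤
      LinearMap.ker (sumEval P) ⊓ stdSpan mo (vanishingIdeal P) := by
    refine Submodule.span_le.mpr ?_
    rintro _ ⟨i, -, rfl⟩
    have hone := fun i => sumEval_indicator (hF i).2.1 (hF i).2.2
    exact ⟨by simp [hone], Submodule.sub_mem _ (hF i).1 (hF _).1⟩
  refine ⟨le_antisymm (fun f hf => ?_)
    (sup_le (hle.trans inf_le_left) (vanishingIdeal_le_ker_sumEval P)),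
    le_antisymm hle fun f hf => ?_⟩
  · exact Submodule.mem_sup.mpr ⟨_, hspan f hf, _, hsub f, add_sub_cancel _ _⟩
  · have h0 := eq_zero_of_mem_of_mem_stdSpan (hsub f) (Submodule.sub_mem _ hf.2
      (Submodule.sum_mem _ fun i _ => Submodule.smul_mem _ _ (hF i).1))
    rw [sub_eq_zero.mp h0]
    exact hspan f hf.1

end
end

section
/- (Duality criterion) Let ≺ be a graded monomial order on S and let r_0 = reg(H_I^a). The following are equivalent: (a) for every −1 ≤ d ≤ r_0, the code C_X(d) is monomially equivalent to C_X(r_0 − d − 1)^⊥; (b) H_I^a(d) + H_I^a(r_0 − d − 1) = |X| for all −1 ≤ d ≤ r_0, and v_{𝔭_i}(I) = r_0 for all 1 ≤ i ≤ m; (c) there exists g ∈ KΔ_≺(I) with g(P_i) ≠ 0 for all i such that C_X(r_0 − d − 1)^⊥ = (g(P_1),…,g(P_m)) · C_X(d) for all −1 ≤ d ≤ r_0. -/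
open MvPolynomial

noncomputable section

variable {K : Type*} [Field K] {s m : ℕ}

theorem eval_eq_evalMap (P : Fin m → (Fin s → K)) (f : MvPolynomial (Fin s) K) (i : Fin m) :
    evalMap P f i = MvPolynomial.eval (P i) f := by
  simp [evalMap, MvPolynomial.aeval_eq_eval]

theorem evalMap_mul (P : Fin m → (Fin s → K)) (f g : MvPolynomial (Fin s) K) :
    evalMap P (f * g) = evalMap P f * evalMap P g := by
  ext i
  simp [eval_eq_evalMap]

theorem mem_vanishingIdeal_points_iff {P : Fin m → (Fin s → K)} {f : MvPolynomial (Fin s) K} :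
    f ∈ vanishingIdeal P ↔ ∀ i, MvPolynomial.eval (P i) f = 0 := by
  simp [_root_.vanishingIdeal, RingHom.mem_ker]

theorem finrank_map_eq_of_ker_eq {V W W' : Type*} [AddCommGroup V] [AddCommGroup W]
    [AddCommGroup W'] [Module K V] [Module K W] [Module K W'] (f : V →ₗ[K] W) (g : V →ₗ[K] W')
    (h : ∀ x, f x = 0 ↔ g x = 0) (L : Submodule K V) :
    Module.finrank K (L.map f) = Module.finrank K (L.map g) := by
  have hk : (f.domRestrict L).ker = (g.domRestrict L).ker := by
    ext x
    simp [h]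
  rw [← LinearMap.range_domRestrict, ← LinearMap.range_domRestrict]
  exact ((f.domRestrict L).quotKerEquivRange.symm.trans
    ((Submodule.quotEquivOfEq _ _ hk).trans (g.domRestrict L).quotKerEquivRange)).finrank_eq

theorem hilbA_eq_finrank_RMcode (P : Fin m → (Fin s → K)) (d : ℕ) :
    hilbA P d = Module.finrank K (RMcode P d) := by
  refine finrank_map_eq_of_ker_eq _ _ (fun x => ?_) _
  simp only [AlgHom.toLinearMap_apply, Ideal.Quotient.mkₐ_eq_mk, Ideal.Quotient.eq_zero_iff_mem,
    mem_vanishingIdeal_points_iff, _root_.funext_iff, eval_eq_evalMap, Pi.zero_apply]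

theorem hilbAZ_eq_finrank_RMcodeZ (P : Fin m → (Fin s → K)) (d : ℤ) :
    hilbAZ P d = Module.finrank K (RMcodeZ P d) := by
  by_cases hd : d < 0
  · rw [hilbAZ, RMcodeZ, if_pos hd, if_pos hd, finrank_bot]
  · rw [hilbAZ, RMcodeZ, if_neg hd, if_neg hd, hilbA_eq_finrank_RMcode]

theorem nondegenerate_dotProductBilin :
    (dotProductBilin K K : LinearMap.BilinForm K (Fin m → K)).Nondegenerate := by
  refine ⟨fun x hx => ?_, fun x hx => ?_⟩ <;> ext i
  · simpa using hx (Pi.single i 1)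
  · simpa using hx (Pi.single i 1)

theorem isRefl_dotProductBilin :
    LinearMap.BilinForm.IsRefl (dotProductBilin K K : LinearMap.BilinForm K (Fin m → K)) := fun x y h => by
  simpa [dotProduct_comm] using h

theorem dualCode_eq_orthogonal (C : Submodule K (Fin m → K)) :
    dualCode C =
      LinearMap.BilinForm.orthogonal (dotProductBilin K K : LinearMap.BilinForm K (Fin m → K)) C := by
  ext x
  refine forall₂_congr fun y _ => ?_
  simp [dotProduct, mul_comm]

theorem finrank_dualCode (C : Submodule K (Fin m → K)) :
    Module.finrank K (dualCode C) + Module.finrank K C = m := by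
  have h := Submodule.finrank_le C
  rw [dualCode_eq_orthogonal, LinearMap.BilinForm.finrank_orthogonal nondegenerate_dotProductBilin]
  rw [Module.finrank_fin_fun] at *
  omega

theorem dualCode_dualCode (C : Submodule K (Fin m → K)) : dualCode (dualCode C) = C := by
  rw [dualCode_eq_orthogonal, dualCode_eq_orthogonal]
  exact LinearMap.BilinForm.orthogonal_orthogonal nondegenerate_dotProductBilin
    isRefl_dotProductBilin C

theorem scaleMap_apply (β v : Fin m → K) : scaleMap β v = β * v := by
  ext i
  simp [scaleMap]

theorem finrank_map_scaleMap {β : Fin m → K} (hβ : ∀ i, β i ≠ 0) (C : Submodule K (Fin m → K)) :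
    Module.finrank K (C.map (scaleMap β)) = Module.finrank K C := by
  refine (LinearEquiv.finrank_eq (Submodule.equivMapOfInjective _ (fun v w h => ?_) C)).symm
  ext i
  simpa [scaleMap_apply, hβ i] using congrFun h i

theorem monomial_mem_stdSpan_sup (mo : MonomialOrder (Fin s))
    (I : Ideal (MvPolynomial (Fin s) K)) (w : mo.syn) :
    monomial (mo.toSyn.symm w) (1 : K) ∈ stdSpan mo I ⊔ I.restrictScalars K := by
  induction w using WellFoundedLT.induction with
  | ind w ih =>
    obtain ⟨a, rfl⟩ := mo.toSyn.surjective w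
    rw [AddEquiv.symm_apply_apply]
    by_cases ha : a ∈ stdMon mo I
    · exact Submodule.mem_sup_left (Submodule.subset_span ⟨a, ha, rfl⟩)
    have ha' : monomial a (1 : K) ∈ initialIdeal mo I := not_not.mp ha
    have himg : initialIdeal mo I = Ideal.span ((fun b => monomial b (1 : K)) ''
        (leadExpo mo '' {f : MvPolynomial (Fin s) K | f ∈ I ∧ f ≠ 0})) := by
      rw [Set.image_image]
      rfl
    rw [himg, mem_ideal_span_monomial_image] at ha'
    obtain ⟨_, ⟨h, ⟨hI, h0⟩, rfl⟩, hle⟩ := ha' a (by simp)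
    change mo.degree h ≤ a at hle
    set q := monomial (a - mo.degree h) (mo.leadingCoeff h)⁻¹ * h with hq
    have hqI : q ∈ I := I.mul_mem_left _ hI
    have hlt : ∀ b ∈ (monomial a 1 - q).support, mo.toSyn b < mo.toSyn a := by
      intro b hb
      have hba : b ≠ a := by
        rintro rfl
        refine mem_support_iff.mp hb ?_
        rw [coeff_sub, hq, coeff_monomial_mul', if_pos tsub_le_self, tsub_tsub_cancel_of_le hle]
        change _ - _ * mo.leadingCoeff h = 0
        rw [inv_mul_cancel₀ (mo.leadingCoeff_ne_zero_iff.mpr h0)]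
        simp
      have hbq : coeff b q ≠ 0 := by
        simpa [coeff_monomial, hba.symm] using hb
      rw [hq, coeff_monomial_mul'] at hbq
      split_ifs at hbq with hab
      · have h1 := mo.le_degree (mem_support_iff.mpr (right_ne_zero_of_mul hbq))
        have h2 : mo.toSyn b ≤ mo.toSyn a := by
          calc mo.toSyn b = mo.toSyn (b - (a - mo.degree h)) + mo.toSyn (a - mo.degree h) := by
                rw [← map_add, tsub_add_cancel_of_le hab]
            _ ≤ mo.toSyn (mo.degree h) + mo.toSyn (a - mo.degree h) := by gcongr
            _ = mo.toSyn a := by rw [← map_add, add_tsub_cancel_of_le hle]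
        exact lt_of_le_of_ne h2 fun h => hba (mo.toSyn.injective h)
      · exact absurd rfl hbq
    rw [← sub_add_cancel (monomial a (1 : K)) q]
    refine add_mem ?_ (Submodule.mem_sup_right hqI)
    rw [MvPolynomial.as_sum (monomial a (1 : K) - q)]
    refine sum_mem fun b hb => ?_
    have := Submodule.smul_mem _ (coeff b (monomial a 1 - q)) (ih _ (hlt b hb))
    simpa [smul_monomial] using this

theorem stdSpan_sup_eq_top (mo : MonomialOrder (Fin s)) (I : Ideal (MvPolynomial (Fin s) K)) :
    stdSpan mo I ⊔ I.restrictScalars K = ⊤ := by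
  refine eq_top_iff.mpr fun f _ => ?_
  rw [f.as_sum]
  refine sum_mem fun b _ => ?_
  have := Submodule.smul_mem _ (coeff b f) (monomial_mem_stdSpan_sup mo I (mo.toSyn b))
  simpa [smul_monomial] using this

theorem exists_stdSpan_evalMap_eq (P : Fin m → (Fin s → K)) (mo : MonomialOrder (Fin s))
    (f : MvPolynomial (Fin s) K) :
    ∃ g ∈ stdSpan mo (vanishingIdeal P), evalMap P g = evalMap P f := by
  have hf : f ∈ stdSpan mo (vanishingIdeal P) ⊔ (vanishingIdeal P).restrictScalars K := by
    rw [stdSpan_sup_eq_top]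
    trivial
  obtain ⟨g, hg, h, hh, rfl⟩ := Submodule.mem_sup.mp hf
  refine ⟨g, hg, ?_⟩
  ext i
  have : MvPolynomial.eval (P i) h = 0 := mem_vanishingIdeal_points_iff.mp hh i
  simp [eval_eq_evalMap, this]

theorem colon_eq_pointIdeal_iff {P : Fin m → (Fin s → K)} (hP : Function.Injective P)
    (f : MvPolynomial (Fin s) K) (i : Fin m) :
    (vanishingIdeal P).colon (Ideal.span {f}) = pointIdeal (P i) ↔ IsIndicator P f i := by
  constructor
  · intro h
    have key : ∀ g, (∀ j, MvPolynomial.eval (P j) g * MvPolynomial.eval (P j) f = 0) ↔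
        MvPolynomial.eval (P i) g = 0 := fun g => by
      have := SetLike.ext_iff.mp h g
      rw [Ideal.mem_colon_span_singleton, mem_vanishingIdeal_points_iff] at this
      simpa [pointIdeal, RingHom.mem_ker] using this
    have hj : ∀ j, j ≠ i → MvPolynomial.eval (P j) f = 0 := by
      intro j hj
      obtain ⟨k, hk⟩ := Function.ne_iff.mp (hP.ne hj)
      have := (key (X k - C (P i k))).mpr (by simp) j
      simpa [sub_eq_zero, hk] using this
    refine ⟨fun h0 => ?_, hj⟩
    have := (key 1).mp fun j => by
      by_cases hji : j = i
      · rw [hji, h0, mul_zero]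
      · rw [hj j hji, mul_zero]
    simp at this
  · rintro ⟨hi, hj⟩
    ext g
    rw [Ideal.mem_colon_span_singleton, mem_vanishingIdeal_points_iff, pointIdeal, RingHom.mem_ker]
    constructor
    · intro h
      simpa [hi] using h i
    · intro h j
      by_cases hji : j = i
      · rw [hji, map_mul, h, zero_mul]
      · rw [map_mul, hj j hji, mul_zero]

theorem vNumAt_eq {P : Fin m → (Fin s → K)} (hP : Function.Injective P) (i : Fin m) :
    vNumAt (vanishingIdeal P) (pointIdeal (P i)) =
      sInf {d | ∃ f : MvPolynomial (Fin s) K, f.totalDegree = d ∧ IsIndicator P f i} := by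
  unfold vNumAt
  congr 1
  ext d
  refine exists_congr fun f => ?_
  rw [colon_eq_pointIdeal_iff hP]
  refine ⟨fun h => h.2, fun h => ⟨?_, h⟩⟩
  rintro rfl
  exact h.2.1 (map_zero _)

theorem single_mem_RMcode_iff (P : Fin m → (Fin s → K)) (d : ℕ) (i : Fin m) :
    Pi.single i 1 ∈ RMcode P d ↔
      ∃ f : MvPolynomial (Fin s) K, f.totalDegree ≤ d ∧ IsIndicator P f i := by
  constructor
  · rintro ⟨f, hf, h⟩
    refine ⟨f, (mem_restrictTotalDegree _ _ _).mp hf, ?_, fun j hj => ?_⟩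
    · simp [← eval_eq_evalMap, h]
    · simp [← eval_eq_evalMap, h, hj]
  · rintro ⟨f, hf, hi, hj⟩
    have : (Pi.single i 1 : Fin m → K) = (MvPolynomial.eval (P i) f)⁻¹ • evalMap P f := by
      ext j
      by_cases hji : j = i
      · subst hji
        simp [eval_eq_evalMap, hi]
      · simp [eval_eq_evalMap, hji, hj j hji]
    rw [this]
    exact Submodule.smul_mem _ _ ⟨f, (mem_restrictTotalDegree _ _ _).mpr hf, rfl⟩

theorem RMcode_zero (P : Fin m → (Fin s → K)) : RMcode P 0 = Submodule.span K {1} := by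
  ext v
  rw [Submodule.mem_span_singleton]
  constructor
  · rintro ⟨f, hf, rfl⟩
    have hf' := Nat.le_zero.mp ((mem_restrictTotalDegree _ _ _).mp hf)
    rw [totalDegree_eq_zero_iff_eq_C] at hf'
    refine ⟨coeff 0 f, ?_⟩
    rw [hf']
    ext i
    simp [eval_eq_evalMap]
  · rintro ⟨c, rfl⟩
    refine ⟨C c, (mem_restrictTotalDegree _ _ _).mpr (by simp), ?_⟩
    ext i
    simp [eval_eq_evalMap]

theorem mul_mem_RMcodeZ (P : Fin m → (Fin s → K)) {d e : ℤ} {u v : Fin m → K}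
    (hu : u ∈ RMcodeZ P d) (hv : v ∈ RMcodeZ P e) : u * v ∈ RMcodeZ P (d + e) := by
  unfold RMcodeZ at hu hv
  split_ifs at hu hv with hd he he
  · rw [(Submodule.mem_bot K).mp hu, zero_mul]
    exact zero_mem _
  · rw [(Submodule.mem_bot K).mp hu, zero_mul]
    exact zero_mem _
  · rw [(Submodule.mem_bot K).mp hv, mul_zero]
    exact zero_mem _
  · obtain ⟨f, hf, rfl⟩ := hu
    obtain ⟨g, hg, rfl⟩ := hv
    rw [RMcodeZ, if_neg (by omega), ← evalMap_mul]
    refine ⟨f * g, (mem_restrictTotalDegree _ _ _).mpr ?_, rfl⟩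
    have h1 := (mem_restrictTotalDegree _ _ _).mp hf
    have h2 := (mem_restrictTotalDegree _ _ _).mp hg
    have := totalDegree_mul f g
    omega

theorem RMcodeZ_natCast (P : Fin m → (Fin s → K)) (d : ℕ) : RMcodeZ P d = RMcode P d := by
  simp [RMcodeZ]

theorem single_mem_iff_apply_eq_zero {C : Submodule K (Fin m → K)} {β : Fin m → K}
    (hC : dualCode C = Submodule.span K {β}) (i : Fin m) :
    Pi.single i 1 ∈ C ↔ β i = 0 := by
  have hβ : β ∈ dualCode C := hC ▸ Submodule.mem_span_singleton_self β
  constructor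
  · intro h
    simpa [Pi.single_apply] using hβ _ h
  · intro h
    rw [← dualCode_dualCode C, hC]
    intro w hw
    obtain ⟨c, rfl⟩ := Submodule.mem_span_singleton.mp hw
    simp [Pi.single_apply, h]

theorem vNumAt_eq_iff {P : Fin m → (Fin s → K)} (hP : Function.Injective P) {r : ℕ}
    (hr : RMcode P (r + 1) = ⊤) (i : Fin m) :
    vNumAt (vanishingIdeal P) (pointIdeal (P i)) = r + 1 ↔ Pi.single i 1 ∉ RMcode P r := by
  rw [vNumAt_eq hP, single_mem_RMcode_iff]
  obtain ⟨f, hf, hfi⟩ := (single_mem_RMcode_iff P (r + 1) i).mp (hr ▸ Submodule.mem_top)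
  constructor
  · rintro h ⟨g, hg, hgi⟩
    have : sInf {d | ∃ f : MvPolynomial (Fin s) K, f.totalDegree = d ∧ IsIndicator P f i} ≤
        g.totalDegree := Nat.sInf_le ⟨g, rfl, hgi⟩
    omega
  · intro h
    refine le_antisymm (le_trans (Nat.sInf_le ⟨f, rfl, hfi⟩) hf) ?_
    refine le_csInf ⟨_, f, rfl, hfi⟩ ?_
    rintro d ⟨g, rfl, hgi⟩
    by_contra hlt
    exact h ⟨g, by omega, hgi⟩

/-- A dual word of `C_X(r)` scales each `C_X(d)` into the dual of `C_X(r - d)`. -/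
theorem map_scaleMap_RMcodeZ_le (P : Fin m → (Fin s → K)) {r : ℕ} {β : Fin m → K}
    (hβ : β ∈ dualCode (RMcode P r)) (d : ℤ) :
    (RMcodeZ P d).map (scaleMap β) ≤ dualCode (RMcodeZ P (r - d)) := by
  rintro _ ⟨u, hu, rfl⟩ v hv
  have huv := mul_mem_RMcodeZ P hu hv
  rw [add_sub_cancel, RMcodeZ_natCast] at huv
  rw [← hβ _ huv]
  refine Finset.sum_congr rfl fun i _ => ?_
  rw [scaleMap_apply]
  simp [mul_assoc]

/-- Duality criterion for Reed–Muller-type codes. -/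
theorem duality_criterion [Fintype K]
    (P : Fin m → (Fin s → K)) (hP : Function.Injective P) (hm : 2 ≤ m)
    (mo : MonomialOrder (Fin s)) (hmo : mo.IsGraded) (r0 : ℕ)
    (hr0 : IsLeast {ℓ : ℕ | ∀ d : ℕ, ℓ ≤ d → hilbA P d = m} r0) :
    ((∀ d : ℤ, -1 ≤ d → d ≤ (r0 : ℤ) →
        ∃ β : Fin m → K, (∀ i, β i ≠ 0) ∧
          dualCode (RMcodeZ P ((r0 : ℤ) - d - 1)) =
            Submodule.map (scaleMap β) (RMcodeZ P d)) ↔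
      ((∀ d : ℤ, -1 ≤ d → d ≤ (r0 : ℤ) →
          hilbAZ P d + hilbAZ P ((r0 : ℤ) - d - 1) = m) ∧
        ∀ i : Fin m, vNumAt (vanishingIdeal P) (pointIdeal (P i)) = r0)) ∧
    (((∀ d : ℤ, -1 ≤ d → d ≤ (r0 : ℤ) →
          hilbAZ P d + hilbAZ P ((r0 : ℤ) - d - 1) = m) ∧
        ∀ i : Fin m, vNumAt (vanishingIdeal P) (pointIdeal (P i)) = r0) ↔
      (∃ g ∈ stdSpan mo (vanishingIdeal P),
        (∀ i : Fin m, MvPolynomial.eval (P i) g ≠ 0) ∧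
        ∀ d : ℤ, -1 ≤ d → d ≤ (r0 : ℤ) →
          dualCode (RMcodeZ P ((r0 : ℤ) - d - 1)) =
            Submodule.map (scaleMap (evalMap P g)) (RMcodeZ P d))) := by
  have htop : RMcode P r0 = ⊤ := by
    refine Submodule.eq_top_of_finrank_eq ?_
    rw [← hilbA_eq_finrank_RMcode, hr0.1 r0 le_rfl, Module.finrank_fin_fun]
  have : NeZero m := ⟨by omega⟩
  have hH0 : Module.finrank K (RMcode P 0) = 1 := by
    rw [RMcode_zero]
    exact finrank_span_singleton one_ne_zero
  obtain ⟨r, rfl⟩ : ∃ r, r0 = r + 1 := by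
    refine Nat.exists_eq_succ_of_ne_zero ?_
    rintro rfl
    rw [htop, finrank_top, Module.finrank_fin_fun] at hH0
    omega
  have hsub : ∀ d : ℤ, ((r + 1 : ℕ) : ℤ) - d - 1 = r - d := fun d => by push_cast; ring
  simp only [hsub, hilbAZ_eq_finrank_RMcodeZ, vNumAt_eq_iff hP htop]
  have hab : (∀ d : ℤ, -1 ≤ d → d ≤ ((r + 1 : ℕ) : ℤ) →
      ∃ β : Fin m → K, (∀ i, β i ≠ 0) ∧
        dualCode (RMcodeZ P (r - d)) = (RMcodeZ P d).map (scaleMap β)) →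
      (∀ d : ℤ, -1 ≤ d → d ≤ ((r + 1 : ℕ) : ℤ) →
        Module.finrank K (RMcodeZ P d) + Module.finrank K (RMcodeZ P (r - d)) = m) ∧
      ∀ i, Pi.single i 1 ∉ RMcode P r := by
    intro h
    constructor
    · intro d h1 h2
      obtain ⟨β, hβ, hd⟩ := h d h1 h2
      rw [← finrank_map_scaleMap hβ (RMcodeZ P d), ← hd]
      exact finrank_dualCode _
    · intro i
      obtain ⟨β, hβ, hd⟩ := h 0 (by omega) (by omega)
      have h0 : RMcodeZ P 0 = Submodule.span K {1} := RMcode_zero P ▸ RMcodeZ_natCast P 0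
      rw [sub_zero, RMcodeZ_natCast, h0, Submodule.map_span, Set.image_singleton,
        scaleMap_apply, mul_one] at hd
      rw [single_mem_iff_apply_eq_zero hd]
      exact hβ i
  have hca : (∃ g ∈ stdSpan mo (vanishingIdeal P),
      (∀ i : Fin m, MvPolynomial.eval (P i) g ≠ 0) ∧
      ∀ d : ℤ, -1 ≤ d → d ≤ ((r + 1 : ℕ) : ℤ) →
        dualCode (RMcodeZ P (r - d)) = (RMcodeZ P d).map (scaleMap (evalMap P g))) →
      ∀ d : ℤ, -1 ≤ d → d ≤ ((r + 1 : ℕ) : ℤ) →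
      ∃ β : Fin m → K, (∀ i, β i ≠ 0) ∧
        dualCode (RMcodeZ P (r - d)) = (RMcodeZ P d).map (scaleMap β) := by
    rintro ⟨g, -, hg, h⟩ d h1 h2
    exact ⟨evalMap P g, fun i => eval_eq_evalMap P g i ▸ hg i, h d h1 h2⟩
  have hbc : ((∀ d : ℤ, -1 ≤ d → d ≤ ((r + 1 : ℕ) : ℤ) →
        Module.finrank K (RMcodeZ P d) + Module.finrank K (RMcodeZ P (r - d)) = m) ∧
      ∀ i, Pi.single i 1 ∉ RMcode P r) →
      ∃ g ∈ stdSpan mo (vanishingIdeal P),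
      (∀ i : Fin m, MvPolynomial.eval (P i) g ≠ 0) ∧
      ∀ d : ℤ, -1 ≤ d → d ≤ ((r + 1 : ℕ) : ℤ) →
        dualCode (RMcodeZ P (r - d)) = (RMcodeZ P d).map (scaleMap (evalMap P g)) := by
    rintro ⟨hdim, hv⟩
    have hone : Module.finrank K (dualCode (RMcode P r)) = 1 := by
      have h1 := hdim 0 (by omega) (by omega)
      have h2 := finrank_dualCode (RMcode P r)
      have h0 : RMcodeZ P 0 = RMcode P 0 := RMcodeZ_natCast P 0
      rw [sub_zero, RMcodeZ_natCast, h0, hH0] at h1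
      omega
    obtain ⟨β, hβ⟩ : ∃ β, dualCode (RMcode P r) = Submodule.span K {β} := by
      obtain ⟨β, -, h⟩ := finrank_eq_one_iff'.mp hone
      refine ⟨β, le_antisymm (fun w hw => ?_) ?_⟩
      · obtain ⟨c, hc⟩ := h ⟨w, hw⟩
        exact Submodule.mem_span_singleton.mpr ⟨c, congrArg Subtype.val hc⟩
      · exact (Submodule.span_singleton_le_iff_mem _ _).mpr β.2
    have hβ0 : ∀ i, β i ≠ 0 := fun i => (single_mem_iff_apply_eq_zero hβ i).not.mp (hv i)
    obtain ⟨f, -, hf⟩ : β ∈ RMcode P (r + 1) := htop ▸ Submodule.mem_top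
    obtain ⟨g, hg, hgf⟩ := exists_stdSpan_evalMap_eq P mo f
    rw [hf] at hgf
    refine ⟨g, hg, fun i => ?_, fun d h1 h2 => ?_⟩
    · rw [← eval_eq_evalMap, hgf]
      exact hβ0 i
    · rw [hgf]
      refine (Submodule.eq_of_le_of_finrank_eq (map_scaleMap_RMcodeZ_le P
        (hβ ▸ Submodule.mem_span_singleton_self β) d) ?_).symm
      have h3 := hdim d h1 h2
      have h4 := finrank_dualCode (RMcodeZ P (r - d))
      rw [finrank_map_scaleMap hβ0]
      omega
  exact ⟨⟨hab, fun h => hca (hbc h)⟩, ⟨hbc, fun h => hab (hca h)⟩⟩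

end
end
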